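/- Let T > 0, let a, b, c, f : (0,T) × (0,1) → ℝ with sup_{0<x<1, 0<t≤T} |f(t,x)| < +∞, and let u ∈ C⁰([0,T] × [0,1]) be such that u[t] ∈ C²((0,1)) for almost all t ∈ (0,T), the partial derivative ∂u/∂t(t,x) exists and is continuous on (0,T) × [0,1], and ∂u/∂t(t,x) = a(t,x)·∂²u/∂x²(t,x) + b(t,x)·∂u/∂x(t,x) + c(t,x)·u(t,x) + f(t,x) for almost all t ∈ (0,T) and all x ∈ (0,1). Suppose a(t,x) ≥ 0 for all t ∈ (0,T), x ∈ (0,1), and that there exist a constant σ > 0 and a positive function η ∈ C²([0,1];(0,+∞)) with a(t,x)η''(x) + b(t,x)η'(x) + (σ + c(t,x))η(x) ≤ 0 for all t ∈ (0,T), x ∈ (0,1). Then for all ζ ∈ [0,σ) and t ∈ (0,T]: ‖u[t]‖_{∞,η} ≤ max( exp(−ζt)·‖u[0]‖_{∞,η}, sup_{0<s≤t} max( |u(s,0)|/η(0), |u(s,1)|/η(1), ‖f[s]‖_{∞,η}/(σ−ζ) )·exp(−ζ(t−s)) ). -/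

import Mathlib

open Set MeasureTheory Filter

lemma second_order_max (w w1 : ℝ → ℝ) (w2 x : ℝ) (hmax : IsLocalMax w x)
    (h1 : ∀ᶠ y in nhds x, HasDerivAt w (w1 y) y) (h2 : HasDerivAt w1 w2 x) :
    w1 x = 0 ∧ w2 ≤ 0 := by
  have e1 : deriv w =ᶠ[nhds x] w1 := h1.mono fun y hy => hy.deriv
  have hx : w1 x = 0 := by
    rw [← h1.self_of_nhds.deriv]; exact hmax.deriv_eq_zero
  refine ⟨hx, ?_⟩
  by_contra hlt
  push Not at hlt
  have hdd : deriv (deriv w) x = w2 := by rw [e1.deriv_eq, h2.deriv]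
  have hmin : IsLocalMin w x := by
    apply isLocalMin_of_deriv_deriv_pos
    · rw [hdd]; exact hlt
    · exact hmax.deriv_eq_zero
    · exact h1.self_of_nhds.continuousAt
  have hc : w =ᶠ[nhds x] fun _ => w x := by
    filter_upwards [hmax, hmin] with y h3 h4
    exact le_antisymm h3 h4
  have h5 : deriv (deriv w) x = 0 := by
    rw [hc.deriv.deriv_eq]; simp
  linarith

lemma core
    (T : ℝ) (a b c f : ℝ → ℝ → ℝ)
    (u ut ux uxx : ℝ → ℝ → ℝ)
    (hu_cont : ContinuousOn (fun p : ℝ × ℝ => u p.1 p.2) (Set.Icc 0 T ×ˢ Set.Icc 0 1))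
    (hut : ∀ t ∈ Set.Ioo (0:ℝ) T, ∀ x ∈ Set.Icc (0:ℝ) 1,
      HasDerivAt (fun τ => u τ x) (ut t x) t)
    (hut_cont : ContinuousOn (fun p : ℝ × ℝ => ut p.1 p.2) (Set.Ioo 0 T ×ˢ Set.Icc 0 1))
    (hC2_pde : ∀ᵐ t ∂(volume.restrict (Set.Ioo 0 T)),
      (∀ x ∈ Set.Ioo (0:ℝ) 1, HasDerivAt (u t) (ux t x) x) ∧
      (∀ x ∈ Set.Ioo (0:ℝ) 1, HasDerivAt (ux t) (uxx t x) x) ∧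
      (∀ x ∈ Set.Ioo (0:ℝ) 1,
        ut t x = a t x * uxx t x + b t x * ux t x + c t x * u t x + f t x))
    (ha : ∀ t ∈ Set.Ioo (0:ℝ) T, ∀ x ∈ Set.Ioo (0:ℝ) 1, 0 ≤ a t x)
    (σ : ℝ)
    (η η' η'' : ℝ → ℝ)
    (hη_pos : ∀ x ∈ Set.Icc (0:ℝ) 1, 0 < η x)
    (hη1 : ∀ x ∈ Set.Icc (0:ℝ) 1, HasDerivWithinAt η (η' x) (Set.Icc 0 1) x)
    (hη2 : ∀ x ∈ Set.Icc (0:ℝ) 1, HasDerivWithinAt η' (η'' x) (Set.Icc 0 1) x)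
    (hcond : ∀ t ∈ Set.Ioo (0:ℝ) T, ∀ x ∈ Set.Ioo (0:ℝ) 1,
      a t x * η'' x + b t x * η' x + (σ + c t x) * η x ≤ 0)
    (ζ : ℝ) (hζσ : ζ < σ) (t : ℝ) (ht0 : 0 < t) (htT : t ≤ T) (B : ℝ) (hB : 0 ≤ B)
    (h0 : ∀ x ∈ Set.Icc (0:ℝ) 1, u 0 x * Real.exp (ζ * 0) / η x ≤ B)
    (hl : ∀ s ∈ Set.Ioc 0 t, u s 0 * Real.exp (ζ * s) / η 0 ≤ B)
    (hr : ∀ s ∈ Set.Ioc 0 t, u s 1 * Real.exp (ζ * s) / η 1 ≤ B)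
    (hf : ∀ s ∈ Set.Ioc 0 t, ∀ x ∈ Set.Ioo (0:ℝ) 1,
      f s x * Real.exp (ζ * s) / η x ≤ (σ - ζ) * B) :
    ∀ x ∈ Set.Icc (0:ℝ) 1, u t x * Real.exp (ζ * t) / η x ≤ B := by
  intro x1 hx1
  by_contra hcon
  push Not at hcon
  have hηc : ContinuousOn η (Icc 0 1) := fun x hx => (hη1 x hx).continuousWithinAt
  set V : ℝ × ℝ → ℝ := fun p => u p.1 p.2 * Real.exp (ζ * p.1) / η p.2 with hV
  have hηc2 : ∀ S : Set ℝ, ContinuousOn (fun p : ℝ × ℝ => η p.2) (S ×ˢ Icc 0 1) := fun S =>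
    hηc.comp continuousOn_snd (fun p hp => hp.2)
  have hVc : ContinuousOn V (Icc 0 T ×ˢ Icc 0 1) := by
    refine (hu_cont.mul ?_).div (hηc2 _) (fun p hp => (hη_pos _ hp.2).ne')
    fun_prop
  -- an earlier time
  obtain ⟨s1, hs1, hs1B⟩ : ∃ s1 ∈ Ioo 0 t, B < V (s1, x1) := by
    have hc : ContinuousWithinAt (fun s => V (s, x1)) (Icc 0 t) t := by
      have : ContinuousOn (fun s => V (s, x1)) (Icc 0 t) :=
        hVc.comp (by fun_prop) (fun s hs => ⟨⟨hs.1, hs.2.trans htT⟩, hx1⟩)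
      exact this t ⟨ht0.le, le_rfl⟩
    have hev : ∀ᶠ s in nhdsWithin t (Icc 0 t), B < V (s, x1) := hc.eventually (lt_mem_nhds hcon)
    have hev2 : ∀ᶠ s in nhdsWithin t (Iio t), B < V (s, x1) := by
      rw [← nhdsWithin_Ioo_eq_nhdsLT ht0]
      exact hev.filter_mono (nhdsWithin_mono _ Ioo_subset_Icc_self)
    obtain ⟨s, h1, h2⟩ := (hev2.and (Ioo_mem_nhdsLT ht0)).exists
    exact ⟨s, h2, h1⟩
  -- max over [0,s1] × [0,1]
  obtain ⟨⟨s0, x0⟩, hp0, hmax⟩ := (isCompact_Icc.prod isCompact_Icc :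
      IsCompact (Icc (0:ℝ) s1 ×ˢ Icc (0:ℝ) 1)).exists_isMaxOn
      ⟨(s1, x1), ⟨⟨hs1.1.le, le_rfl⟩, hx1⟩⟩
      (hVc.mono (prod_mono (Icc_subset_Icc le_rfl (hs1.2.le.trans htT)) le_rfl))
  have hMB : B < V (s0, x0) := hs1B.trans_le (hmax ⟨⟨hs1.1.le, le_rfl⟩, hx1⟩)
  have hx0 : x0 ∈ Icc (0:ℝ) 1 := hp0.2
  have hs0pos : 0 < s0 := by
    rcases hp0.1.1.lt_or_eq with h | h
    · exact h
    · exfalso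
      have := h0 x0 hx0
      simp only at h
      subst h
      exact absurd hMB (not_lt.mpr this)
  have hs0t : s0 ∈ Ioo 0 t := ⟨hs0pos, hp0.1.2.trans_lt hs1.2⟩
  -- good times
  rw [ae_restrict_iff' measurableSet_Ioo] at hC2_pde
  have hdense := Measure.dense_of_ae hC2_pde
  have hcl := hdense.open_subset_closure_inter (isOpen_Ioo (a := 0) (b := t)) hs0t
  obtain ⟨S, hS, hSlim⟩ := mem_closure_iff_seq_limit.mp hcl
  have hST : ∀ n, S n ∈ Ioo 0 T := fun n => ⟨(hS n).1.1, (hS n).1.2.trans_le htT⟩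
  -- maxima
  have hX : ∀ n, ∃ x ∈ Icc (0:ℝ) 1, ∀ y ∈ Icc (0:ℝ) 1, V (S n, y) ≤ V (S n, x) := by
    intro n
    have : ContinuousOn (fun y => V (S n, y)) (Icc 0 1) :=
      hVc.comp (by fun_prop) (fun y hy => ⟨Ioo_subset_Icc_self (hST n), hy⟩)
    obtain ⟨x, hx, hm⟩ := isCompact_Icc.exists_isMaxOn ⟨x0, hx0⟩ this
    exact ⟨x, hx, fun y hy => hm hy⟩
  choose X hXm hXmax using hX
  obtain ⟨xs, hxs, φ, hφ, hφlim⟩ := isCompact_Icc.tendsto_subseq hXm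
  have hSφ : Tendsto (S ∘ φ) atTop (nhds s0) := hSlim.comp hφ.tendsto_atTop
  have hs0T : s0 ∈ Ioo 0 T := ⟨hs0t.1, hs0t.2.trans_le htT⟩
  have hpair : Tendsto (fun n => (S (φ n), X (φ n))) atTop
      (nhdsWithin (s0, xs) (Ioo 0 T ×ˢ Icc 0 1)) :=
    tendsto_nhdsWithin_iff.mpr ⟨hSφ.prodMk_nhds hφlim,
      Eventually.of_forall fun n => ⟨hST _, hXm _⟩⟩
  have hpair0 : Tendsto (fun n => (S (φ n), x0)) atTop
      (nhdsWithin (s0, x0) (Ioo 0 T ×ˢ Icc 0 1)) :=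
    tendsto_nhdsWithin_iff.mpr ⟨hSφ.prodMk_nhds tendsto_const_nhds,
      Eventually.of_forall fun n => ⟨hST _, hx0⟩⟩
  have hVc' : ContinuousOn V (Ioo 0 T ×ˢ Icc 0 1) :=
    hVc.mono (prod_mono Ioo_subset_Icc_self le_rfl)
  have hVlim : Tendsto (fun n => V (S (φ n), X (φ n))) atTop (nhds (V (s0, xs))) :=
    (hVc' (s0, xs) ⟨hs0T, hxs⟩).tendsto.comp hpair
  have hVlim0 : Tendsto (fun n => V (S (φ n), x0)) atTop (nhds (V (s0, x0))) :=
    (hVc' (s0, x0) ⟨hs0T, hx0⟩).tendsto.comp hpair0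
  have hVge : V (s0, x0) ≤ V (s0, xs) :=
    le_of_tendsto_of_tendsto' hVlim0 hVlim (fun n => hXmax _ _ hx0)
  have hxsB : B < V (s0, xs) := hMB.trans_le hVge
  set W : ℝ × ℝ → ℝ := fun p =>
    (ut p.1 p.2 + ζ * u p.1 p.2) * Real.exp (ζ * p.1) / η p.2 with hW
  have hWc : ContinuousOn W (Ioo 0 T ×ˢ Icc 0 1) := by
    refine ContinuousOn.div (ContinuousOn.mul (hut_cont.add (continuousOn_const.mul
      (hu_cont.mono (prod_mono Ioo_subset_Icc_self le_rfl)))) ?_) (hηc2 _)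
      (fun p hp => (hη_pos _ hp.2).ne')
    fun_prop
  have hWlim : Tendsto (fun n => W (S (φ n), X (φ n))) atTop (nhds (W (s0, xs))) :=
    (hWc (s0, xs) ⟨hs0T, hxs⟩).tendsto.comp hpair
  have hWle : ∀ᶠ n in atTop, W (S (φ n), X (φ n)) ≤ (σ - ζ) * (B - V (S (φ n), X (φ n))) := by
    filter_upwards [hVlim.eventually (lt_mem_nhds hxsB)] with n hn
    have hgood := (hS (φ n)).2 (hST (φ n))
    have hm := hXmax (φ n)
    have hxm := hXm (φ n)
    have hst := (hS (φ n)).1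
    have hsT := hST (φ n)
    generalize S (φ n) = s at *
    generalize X (φ n) = x at *
    have hxI : x ∈ Ioo (0:ℝ) 1 := by
      refine ⟨lt_of_le_of_ne hxm.1 ?_, lt_of_le_of_ne hxm.2 ?_⟩
      · rintro rfl
        exact absurd hn (not_lt.mpr (hl s ⟨hst.1, hst.2.le⟩))
      · rintro rfl
        exact absurd hn (not_lt.mpr (hr s ⟨hst.1, hst.2.le⟩))
    obtain ⟨g1, g2, g3⟩ := hgood
    have hηx := hη_pos x hxm
    have hE : 0 < Real.exp (ζ * s) := Real.exp_pos _
    obtain ⟨k, hk⟩ : ∃ k, k = u s x / η x := ⟨_, rfl⟩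
    have huk : u s x = k * η x := by rw [hk]; field_simp
    have hVk : V (s, x) = k * Real.exp (ζ * s) := by
      simp only [hV]; rw [huk]; field_simp
    have hkpos : 0 ≤ k := by
      by_contra hneg
      push Not at hneg
      have := mul_neg_of_neg_of_pos hneg hE
      linarith
    have hIcc : ∀ y ∈ Ioo (0:ℝ) 1, Icc (0:ℝ) 1 ∈ nhds y := fun y hy => Icc_mem_nhds hy.1 hy.2
    have hso := second_order_max (fun y => u s y - k * η y) (fun y => ux s y - k * η' y)
      (uxx s x - k * η'' x) x
      (by
        filter_upwards [hIcc x hxI] with y hy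
        have h1 := hm y hy
        rw [hVk] at h1
        simp only [hV] at h1
        rw [div_le_iff₀ (hη_pos y hy)] at h1
        have h2 : u s y ≤ k * η y := by
          by_contra h3
          push Not at h3
          have := mul_lt_mul_of_pos_right h3 hE
          linarith
        simp only [huk]
        linarith)
      (by
        filter_upwards [isOpen_Ioo.mem_nhds hxI] with y hy
        exact (g1 y hy).sub
          (((hη1 y (Ioo_subset_Icc_self hy)).hasDerivAt (hIcc y hy)).const_mul k))
      ((g2 x hxI).sub (((hη2 x hxm).hasDerivAt (hIcc x hxI)).const_mul k))
    obtain ⟨so1, so2⟩ := hso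
    have hux : ux s x = k * η' x := by linarith
    have hut' : ut s x ≤ -σ * (k * η x) + f s x := by
      rw [g3 x hxI, hux, huk]
      have e1 := mul_le_mul_of_nonneg_left so2 (ha s hsT x hxI)
      have e2 := mul_le_mul_of_nonneg_left (hcond s hsT x hxI) hkpos
      nlinarith
    have hff := hf s ⟨hst.1, hst.2.le⟩ x hxI
    have e3 : W (s, x) ≤ (ζ - σ) * (k * Real.exp (ζ * s)) + f s x * Real.exp (ζ * s) / η x := by
      have e4 : (ζ - σ) * (k * Real.exp (ζ * s)) + f s x * Real.exp (ζ * s) / η x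
        = ((-σ * (k * η x) + f s x) + ζ * (k * η x)) * Real.exp (ζ * s) / η x := by
        field_simp
        ring
      rw [e4]
      simp only [hW]
      rw [huk]
      gcongr
    rw [hVk]
    linarith
  have hWneg : W (s0, xs) < 0 := by
    have h1 : W (s0, xs) ≤ (σ - ζ) * (B - V (s0, xs)) :=
      le_of_tendsto_of_tendsto hWlim ((hVlim.const_sub B).const_mul (σ - ζ)) hWle
    have : (σ - ζ) * (B - V (s0, xs)) < 0 :=
      mul_neg_of_pos_of_neg (by linarith) (by linarith)
    linarith
  have hder : HasDerivAt (fun τ => V (τ, xs)) (W (s0, xs)) s0 := by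
    have h1 := ((hut s0 hs0T xs hxs).mul
      (((hasDerivAt_id s0).const_mul ζ).exp)).div_const (η xs)
    refine h1.congr_deriv ?_
    simp only [hW, id]
    ring
  have hslope := hasDerivAt_iff_tendsto_slope.mp hder
  have hslope' : Tendsto (slope (fun τ => V (τ, xs)) s0) (nhdsWithin s0 (Iio s0))
      (nhds (W (s0, xs))) :=
    hslope.mono_left (nhdsWithin_mono _ (fun y hy => ne_of_lt hy))
  obtain ⟨r, hr1, hr2⟩ := ((hslope'.eventually (gt_mem_nhds hWneg)).and
    (Ioo_mem_nhdsLT hs0pos)).exists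
  have hle : V (r, xs) ≤ V (s0, xs) :=
    (hmax (show (r, xs) ∈ Icc 0 s1 ×ˢ Icc 0 1 from
      ⟨⟨hr2.1.le, hr2.2.le.trans hp0.1.2⟩, hxs⟩)).trans hVge
  rw [slope_def_field] at hr1
  have : 0 ≤ (V (r, xs) - V (s0, xs)) / (r - s0) :=
    div_nonneg_of_nonpos (by linarith) (by linarith [hr2.2])
  linarith

/-- **Theorem 2.1** (Karafyllis–Krstic, ISS estimates in the spatial sup-norm):
ISS-style maximum principle estimate in a weighted sup norm for classical solutions
of a 1-D linear (time/space varying) parabolic PDE with Dirichlet boundary data. -/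
theorem thm2_1
    (T : ℝ) (hT : 0 < T)
    (a b c f : ℝ → ℝ → ℝ)
    (hf_bdd : ∃ M : ℝ, ∀ t ∈ Set.Ioc (0:ℝ) T, ∀ x ∈ Set.Ioo (0:ℝ) 1, |f t x| ≤ M)
    (u ut ux uxx : ℝ → ℝ → ℝ)
    (hu_cont : ContinuousOn (fun p : ℝ × ℝ => u p.1 p.2) (Set.Icc 0 T ×ˢ Set.Icc 0 1))
    (hut : ∀ t ∈ Set.Ioo (0:ℝ) T, ∀ x ∈ Set.Icc (0:ℝ) 1,
      HasDerivAt (fun τ => u τ x) (ut t x) t)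
    (hut_cont : ContinuousOn (fun p : ℝ × ℝ => ut p.1 p.2) (Set.Ioo 0 T ×ˢ Set.Icc 0 1))
    (hC2_pde : ∀ᵐ t ∂(volume.restrict (Set.Ioo 0 T)),
      (∀ x ∈ Set.Ioo (0:ℝ) 1, HasDerivAt (u t) (ux t x) x) ∧
      (∀ x ∈ Set.Ioo (0:ℝ) 1, HasDerivAt (ux t) (uxx t x) x) ∧
      ContinuousOn (uxx t) (Set.Ioo 0 1) ∧
      (∀ x ∈ Set.Ioo (0:ℝ) 1,
        ut t x = a t x * uxx t x + b t x * ux t x + c t x * u t x + f t x))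
    (ha : ∀ t ∈ Set.Ioo (0:ℝ) T, ∀ x ∈ Set.Ioo (0:ℝ) 1, 0 ≤ a t x)
    (σ : ℝ) (hσ : 0 < σ)
    (η η' η'' : ℝ → ℝ)
    (hη_pos : ∀ x ∈ Set.Icc (0:ℝ) 1, 0 < η x)
    (hη1 : ∀ x ∈ Set.Icc (0:ℝ) 1, HasDerivWithinAt η (η' x) (Set.Icc 0 1) x)
    (hη2 : ∀ x ∈ Set.Icc (0:ℝ) 1, HasDerivWithinAt η' (η'' x) (Set.Icc 0 1) x)
    (hη''_cont : ContinuousOn η'' (Set.Icc 0 1))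
    (hcond : ∀ t ∈ Set.Ioo (0:ℝ) T, ∀ x ∈ Set.Ioo (0:ℝ) 1,
      a t x * η'' x + b t x * η' x + (σ + c t x) * η x ≤ 0) :
    ∀ ζ ∈ Set.Ico (0:ℝ) σ, ∀ t ∈ Set.Ioc (0:ℝ) T,
      sSup ((fun x => |u t x| / η x) '' Set.Icc 0 1) ≤
        max (Real.exp (-ζ * t) * sSup ((fun x => |u 0 x| / η x) '' Set.Icc 0 1))
          (sSup ((fun s =>
              max (max (|u s 0| / η 0) (|u s 1| / η 1))
                  (sSup ((fun x => |f s x| / η x) '' Set.Ioo 0 1) / (σ - ζ)) *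
              Real.exp (-ζ * (t - s))) '' Set.Ioc 0 t)) := by
  rintro ζ ⟨hζ0, hζσ⟩ t ⟨ht0, htT⟩
  have hd : 0 < σ - ζ := by linarith
  have hηc : ContinuousOn η (Icc 0 1) := fun x hx => (hη1 x hx).continuousWithinAt
  have i0 : (0:ℝ) ∈ Icc (0:ℝ) 1 := ⟨le_rfl, zero_le_one⟩
  have i1 : (1:ℝ) ∈ Icc (0:ℝ) 1 := ⟨zero_le_one, le_rfl⟩
  have hx_cont : ∀ s ∈ Icc 0 T, ContinuousOn (fun x => |u s x| / η x) (Icc 0 1) := by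
    intro s hs
    have : ContinuousOn (fun x => u s x) (Icc 0 1) :=
      hu_cont.comp (f := fun x => (s, x)) (by fun_prop) (fun x hx => ⟨hs, hx⟩)
    exact this.abs.div hηc (fun x hx => (hη_pos x hx).ne')
  have hs_cont : ∀ x ∈ Icc (0:ℝ) 1, ContinuousOn (fun s => |u s x| / η x) (Icc 0 T) := by
    intro x hx
    have : ContinuousOn (fun s => u s x) (Icc 0 T) :=
      hu_cont.comp (f := fun s => (s, x)) (by fun_prop) (fun s hs => ⟨hs, hx⟩)
    exact this.abs.div_const _
  obtain ⟨M, hM⟩ := hf_bdd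
  obtain ⟨xm, hxm, hmin⟩ := isCompact_Icc.exists_isMinOn ⟨0, i0⟩ hηc
  have hmpos := hη_pos xm hxm
  have hfb : ∀ s ∈ Ioc 0 T, ∀ x ∈ Ioo (0:ℝ) 1, |f s x| / η x ≤ M / η xm := by
    intro s hs x hx
    exact div_le_div₀ ((abs_nonneg _).trans (hM s hs x hx)) (hM s hs x hx) hmpos
      (hmin (Ioo_subset_Icc_self hx))
  have hfbdd : ∀ s ∈ Ioc 0 T, BddAbove ((fun x => |f s x| / η x) '' Ioo 0 1) := by
    rintro s hs
    refine ⟨M / η xm, ?_⟩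
    rintro _ ⟨x, hx, rfl⟩
    exact hfb s hs x hx
  set g : ℝ → ℝ := fun s =>
              max (max (|u s 0| / η 0) (|u s 1| / η 1))
                  (sSup ((fun x => |f s x| / η x) '' Set.Ioo 0 1) / (σ - ζ)) *
              Real.exp (-ζ * (t - s)) with hg
  have hgbdd : BddAbove (g '' Ioc 0 t) := by
    obtain ⟨C0, hC0⟩ := isCompact_Icc.bddAbove_image (hs_cont 0 i0)
    obtain ⟨C1, hC1⟩ := isCompact_Icc.bddAbove_image (hs_cont 1 i1)
    refine ⟨max (max C0 C1) (M / η xm / (σ - ζ)), ?_⟩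
    rintro _ ⟨s, hs, rfl⟩
    have hsT : s ∈ Ioc 0 T := ⟨hs.1, hs.2.trans htT⟩
    have b1 : max (max (|u s 0| / η 0) (|u s 1| / η 1))
        (sSup ((fun x => |f s x| / η x) '' Set.Ioo 0 1) / (σ - ζ)) ≤
        max (max C0 C1) (M / η xm / (σ - ζ)) := by
      refine max_le_max (max_le_max (hC0 ⟨s, Ioc_subset_Icc_self hsT, rfl⟩)
        (hC1 ⟨s, Ioc_subset_Icc_self hsT, rfl⟩)) ?_
      refine div_le_div_of_nonneg_right (csSup_le ⟨_, ⟨1/2, by norm_num, rfl⟩⟩ ?_) hd.le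
      rintro _ ⟨x, hx, rfl⟩
      exact hfb s hsT x hx
    have b0 : 0 ≤ max (max (|u s 0| / η 0) (|u s 1| / η 1))
        (sSup ((fun x => |f s x| / η x) '' Set.Ioo 0 1) / (σ - ζ)) :=
      le_max_of_le_left (le_max_of_le_left (div_nonneg (abs_nonneg _) (hη_pos 0 i0).le))
    have b2 : Real.exp (-ζ * (t - s)) ≤ 1 := by
      rw [Real.exp_le_one_iff]
      nlinarith [mul_nonneg hζ0 (sub_nonneg.mpr hs.2)]
    exact (mul_le_of_le_one_right b0 b2).trans b1
  set R := max (Real.exp (-ζ * t) * sSup ((fun x => |u 0 x| / η x) '' Set.Icc 0 1))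
          (sSup (g '' Ioc 0 t)) with hR
  have hET : 0 < Real.exp (ζ * t) := Real.exp_pos _
  have hgR : ∀ s ∈ Ioc 0 t, max (max (|u s 0| / η 0) (|u s 1| / η 1))
                  (sSup ((fun x => |f s x| / η x) '' Set.Ioo 0 1) / (σ - ζ)) *
              Real.exp (ζ * s) ≤ R * Real.exp (ζ * t) := by
    intro s hs
    have h1 : g s ≤ R := (le_csSup hgbdd ⟨s, hs, rfl⟩).trans (le_max_right _ _)
    have h2 := mul_le_mul_of_nonneg_right h1 hET.le
    simp only [hg] at h2
    rw [mul_assoc, ← Real.exp_add] at h2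
    have h3 : -ζ * (t - s) + ζ * t = ζ * s := by ring
    rw [h3] at h2
    exact h2
  have hlR : ∀ s ∈ Ioc 0 t, |u s 0| / η 0 * Real.exp (ζ * s) ≤ R * Real.exp (ζ * t) :=
    fun s hs => (mul_le_mul_of_nonneg_right ((le_max_left _ _).trans (le_max_left _ _))
      (Real.exp_pos _).le).trans (hgR s hs)
  have hrR : ∀ s ∈ Ioc 0 t, |u s 1| / η 1 * Real.exp (ζ * s) ≤ R * Real.exp (ζ * t) :=
    fun s hs => (mul_le_mul_of_nonneg_right ((le_max_right _ _).trans (le_max_left _ _))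
      (Real.exp_pos _).le).trans (hgR s hs)
  have hfR : ∀ s ∈ Ioc 0 t, ∀ x ∈ Ioo (0:ℝ) 1,
      |f s x| / η x * Real.exp (ζ * s) ≤ (σ - ζ) * (R * Real.exp (ζ * t)) := by
    intro s hs x hx
    have h1 := (mul_le_mul_of_nonneg_right (le_max_right _ _)
      (Real.exp_pos _).le).trans (hgR s hs)
    have h2 : |f s x| / η x ≤ sSup ((fun x => |f s x| / η x) '' Set.Ioo 0 1) :=
      le_csSup (hfbdd s ⟨hs.1, hs.2.trans htT⟩) ⟨x, hx, rfl⟩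
    have h3 := mul_le_mul_of_nonneg_left h1 hd.le
    have h4 : (σ - ζ) * (sSup ((fun x => |f s x| / η x) '' Set.Ioo 0 1) / (σ - ζ) *
      Real.exp (ζ * s)) = sSup ((fun x => |f s x| / η x) '' Set.Ioo 0 1) *
      Real.exp (ζ * s) := by field_simp
    rw [h4] at h3
    exact (mul_le_mul_of_nonneg_right h2 (Real.exp_pos _).le).trans h3
  have h0R : ∀ x ∈ Icc (0:ℝ) 1, |u 0 x| / η x * Real.exp (ζ * 0) ≤ R * Real.exp (ζ * t) := by
    intro x hx
    have h1 : |u 0 x| / η x ≤ sSup ((fun x => |u 0 x| / η x) '' Set.Icc 0 1) :=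
      le_csSup (isCompact_Icc.bddAbove_image (hx_cont 0 ⟨le_rfl, hT.le⟩)) ⟨x, hx, rfl⟩
    have h2 := mul_le_mul_of_nonneg_right (le_max_left _ _ : _ ≤ R) hET.le
    have h3 : Real.exp (-ζ * t) * Real.exp (ζ * t) = 1 := by
      rw [← Real.exp_add]; simp
    rw [mul_right_comm, h3, one_mul] at h2
    rw [mul_zero, Real.exp_zero, mul_one]
    exact h1.trans h2
  have hB : 0 ≤ R * Real.exp (ζ * t) :=
    (mul_nonneg (div_nonneg (abs_nonneg _) (hη_pos 0 i0).le) (Real.exp_pos _).le).trans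
      (h0R 0 i0)
  have key : ∀ v y E : ℝ, 0 < y → 0 < E → v * E / y ≤ |v| / y * E := by
    intro v y E hy hE
    rw [div_mul_eq_mul_div]
    gcongr
    exact le_abs_self v
  have key' : ∀ v y E : ℝ, 0 < y → 0 < E → (-v) * E / y ≤ |v| / y * E := by
    intro v y E hy hE
    have := key (-v) y E hy hE
    rwa [abs_neg] at this
  have hp := core T a b c f u ut ux uxx hu_cont hut hut_cont
    (by filter_upwards [hC2_pde] with s hs using ⟨hs.1, hs.2.1, hs.2.2.2⟩) ha σ η η' η'' hη_pos
    hη1 hη2 hcond ζ hζσ t ht0 htT _ hB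
    (fun x hx => (key _ _ _ (hη_pos x hx) (Real.exp_pos _)).trans (h0R x hx))
    (fun s hs => (key _ _ _ (hη_pos 0 i0) (Real.exp_pos _)).trans (hlR s hs))
    (fun s hs => (key _ _ _ (hη_pos 1 i1) (Real.exp_pos _)).trans (hrR s hs))
    (fun s hs x hx => (key _ _ _ (hη_pos x (Ioo_subset_Icc_self hx)) (Real.exp_pos _)).trans
      (hfR s hs x hx))
  have hn := core T a b c (fun s x => - f s x) (fun s x => - u s x) (fun s x => - ut s x)
    (fun s x => - ux s x) (fun s x => - uxx s x) hu_cont.neg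
    (fun s hs x hx => (hut s hs x hx).neg) hut_cont.neg
    (by
      filter_upwards [hC2_pde] with s hs
      refine ⟨fun x hx => (hs.1 x hx).neg, fun x hx => (hs.2.1 x hx).neg, fun x hx => ?_⟩
      rw [hs.2.2.2 x hx]
      ring) ha σ η η' η'' hη_pos
    hη1 hη2 hcond ζ hζσ t ht0 htT _ hB
    (fun x hx => (key' _ _ _ (hη_pos x hx) (Real.exp_pos _)).trans (h0R x hx))
    (fun s hs => (key' _ _ _ (hη_pos 0 i0) (Real.exp_pos _)).trans (hlR s hs))
    (fun s hs => (key' _ _ _ (hη_pos 1 i1) (Real.exp_pos _)).trans (hrR s hs))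
    (fun s hs x hx => (key' _ _ _ (hη_pos x (Ioo_subset_Icc_self hx)) (Real.exp_pos _)).trans
      (hfR s hs x hx))
  refine csSup_le ⟨_, ⟨0, i0, rfl⟩⟩ ?_
  rintro _ ⟨x, hx, rfl⟩
  have h1 := hp x hx
  have h2 := hn x hx
  have hηx := hη_pos x hx
  rw [mul_div_right_comm] at h1 h2
  have h1' := le_of_mul_le_mul_right h1 hET
  have h2' := le_of_mul_le_mul_right h2 hET
  rw [div_le_iff₀ hηx] at h1' h2'
  simp only
  rw [div_le_iff₀ hηx]
  exact abs_le'.mpr ⟨h1', h2'⟩
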